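/- With M, X, e, f, C, A, M', C', A' and ω as in the setup: no row of A contains three pairwise distinct non-zero entries, and no column of A contains three pairwise distinct non-zero entries; that is, neither A nor Aᵀ has a submatrix of the form [x y z] where x, y, z are distinct non-zero elements of GF(4). -/

import Mathlib

open Matroid Set
open scoped Classical

namespace Relax

variable {α β : Type*}

/-- A circuit of a matroid: a minimal dependent set. -/
def Circuit (M : Matroid α) (C : Set α) : Prop :=
  M.Dep C ∧ ∀ D ⊂ C, M.Indep D

/-- A hyperplane of a matroid: a maximal proper flat. -/
def Hyperplane (M : Matroid α) (H : Set α) : Prop :=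
  M.IsFlat H ∧ H ≠ M.E ∧ ∀ F, M.IsFlat F → H ⊂ F → F = M.E

/-- `X` is a circuit-hyperplane of `M`. -/
def CircuitHyperplane (M : Matroid α) (X : Set α) : Prop :=
  Circuit M X ∧ Hyperplane M X

/-- `M'` is obtained from `M` by relaxing the circuit-hyperplane `X` : the ground set is
unchanged and the bases of `M'` are exactly the bases of `M` together with `X`. -/
def IsRelaxation (M M' : Matroid α) (X : Set α) : Prop :=
  CircuitHyperplane M X ∧ M'.E = M.E ∧ ∀ B, (M'.IsBase B ↔ M.IsBase B ∨ B = X)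

/-- A matroid is representable over a field `F` if there is an assignment of vectors to its
elements under which independence coincides with linear independence. -/
def Representable (M : Matroid α) (F : Type*) [Field F] : Prop :=
  ∃ (n : ℕ) (φ : α → (Fin n → F)), ∀ I ⊆ M.E,
    (M.Indep I ↔ LinearIndependent F (fun x : I => φ (x : α)))

/-- The field GF(4). -/
abbrev GF4 := GaloisField 2 2

/-- The rank of a set in a matroid: the maximum size of an independent subset. -/
noncomputable def rk (M : Matroid α) (X : Set α) : ℕ :=
  sSup {n | ∃ I, M.Indep I ∧ I ⊆ X ∧ I.ncard = n}

/-- Deletion of a set of elements. -/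
def delete (M : Matroid α) (D : Set α) : Matroid α := M ↾ (M.E \ D)

/-- Contraction of a set of elements. -/
def contract (M : Matroid α) (C : Set α) : Matroid α := (delete M✶ C)✶

/-- `N` is a minor of `M`. -/
def MinorOf (N M : Matroid α) : Prop :=
  ∃ C D, C ⊆ M.E ∧ D ⊆ M.E ∧ Disjoint C D ∧ N = delete (contract M C) D

/-- Isomorphism of matroids. -/
def Iso (M : Matroid α) (N : Matroid β) : Prop :=
  ∃ e : M.E ≃ N.E, ∀ I : Set M.E,
    M.Indep ((↑) '' I) ↔ N.Indep ((↑) '' (e '' I))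

/-- `M` has a minor isomorphic to `N`. -/
def HasMinorIso (M : Matroid α) (N : Matroid β) : Prop :=
  ∃ M₀ : Matroid α, MinorOf M₀ M ∧ Iso M₀ N

/-- `M` has a minor isomorphic to a member of the set `𝒩` of matroids. -/
def HasMinorIn (M : Matroid α) (𝒩 : Set (Matroid β)) : Prop :=
  ∃ N ∈ 𝒩, HasMinorIso M N

/-- `M` is `𝒩`-fragile. -/
def Fragile (M : Matroid α) (𝒩 : Set (Matroid β)) : Prop :=
  HasMinorIn M 𝒩 ∧
    ∀ a ∈ M.E, ¬ (HasMinorIn (delete M {a}) 𝒩 ∧ HasMinorIn (contract M {a}) 𝒩)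

/-- `M` is (isomorphic to) the uniform matroid `U_{r,n}`. -/
def IsUniform (M : Matroid α) (r n : ℕ) : Prop :=
  M.E.Finite ∧ M.E.ncard = n ∧ ∀ I ⊆ M.E, (M.Indep I ↔ I.ncard ≤ r)

/-- `M` has a minor isomorphic to `U_{r,n}`. -/
def HasUnifMinor (M : Matroid α) (r n : ℕ) : Prop :=
  ∃ M₀, MinorOf M₀ M ∧ IsUniform M₀ r n

/-- `M` has a `{U_{2,5}, U_{3,5}}`-minor. -/
def HasU25U35Minor (M : Matroid α) : Prop :=
  HasUnifMinor M 2 5 ∨ HasUnifMinor M 3 5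

/-- `M` is `U_{2,4}`-fragile. -/
def FragileU24 (M : Matroid α) : Prop :=
  HasUnifMinor M 2 4 ∧
    ∀ a ∈ M.E, ¬ (HasUnifMinor (delete M {a}) 2 4 ∧ HasUnifMinor (contract M {a}) 2 4)

/-- `M` is `{U_{2,5}, U_{3,5}}`-fragile. -/
def FragileU25U35 (M : Matroid α) : Prop :=
  HasU25U35Minor M ∧
    ∀ a ∈ M.E, ¬ (HasU25U35Minor (delete M {a}) ∧ HasU25U35Minor (contract M {a}))

/-- A loop. -/
def Loop (M : Matroid α) (x : α) : Prop := x ∈ M.E ∧ ¬ M.Indep {x}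

/-- Two distinct non-loop elements are parallel if they form a two-element circuit. -/
def Parallel (M : Matroid α) (x y : α) : Prop := x ≠ y ∧ Circuit M {x, y}

/-- A parallel class: a maximal set of pairwise-parallel non-loop elements. -/
def ParallelClass (M : Matroid α) (A : Set α) : Prop :=
  A ⊆ M.E ∧ (∀ x ∈ A, ¬ Loop M x) ∧
    (∀ x ∈ A, ∀ y ∈ A, x ≠ y → Parallel M x y) ∧
    (∀ B, A ⊆ B → B ⊆ M.E → (∀ x ∈ B, ¬ Loop M x) →
      (∀ x ∈ B, ∀ y ∈ B, x ≠ y → Parallel M x y) → B = A)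

/-- A series class: a parallel class of the dual. -/
def SeriesClass (M : Matroid α) (A : Set α) : Prop := ParallelClass M✶ A

/-- A matroid is connected if every two distinct elements lie in a common circuit. -/
def Connected (M : Matroid α) : Prop :=
  ∀ x ∈ M.E, ∀ y ∈ M.E, x ≠ y → ∃ C, Circuit M C ∧ x ∈ C ∧ y ∈ C

/-- A `k`-separation of `M`. -/
def Separation (M : Matroid α) (k : ℕ) (A B : Set α) : Prop :=
  A ∪ B = M.E ∧ Disjoint A B ∧ k ≤ A.ncard ∧ k ≤ B.ncard ∧
    rk M A + rk M B ≤ rk M M.E + (k - 1)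

/-- A matroid is 3-connected if it is connected and has no 2-separation. -/
def ThreeConnected (M : Matroid α) : Prop :=
  Connected M ∧ ∀ A B, ¬ Separation M 2 A B

/-- `M` is 3-connected up to series and parallel classes. -/
def ThreeConnUpToSP (M : Matroid α) : Prop :=
  Connected M ∧ ∀ A B, Separation M 2 A B →
    (SeriesClass M A ∨ ParallelClass M A ∨ SeriesClass M B ∨ ParallelClass M B)

/-- A 3-separating set of `M`. -/
def ThreeSeparating (M : Matroid α) (Y : Set α) : Prop :=
  Y ⊆ M.E ∧ rk M Y + rk M (M.E \ Y) ≤ rk M M.E + 2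

/-- `M` has path width 3: there is an ordering of the ground set all of whose initial
segments are 3-separating. -/
def PathWidth3 (M : Matroid α) : Prop :=
  ∃ (n : ℕ) (e : Fin n → α), Function.Injective e ∧ Set.range e = M.E ∧
    ∀ t : Fin n, ThreeSeparating M (e '' {i | i ≤ t})

/-- A segment: every 3-element subset is a triangle. -/
def Segment (M : Matroid α) (S : Set α) : Prop :=
  S ⊆ M.E ∧ ∀ T ⊆ S, T.ncard = 3 → Circuit M T

/-- A triangle: a 3-element circuit. -/
def Triangle (M : Matroid α) (S : Set α) : Prop := Circuit M S ∧ S.ncard = 3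

/-! ### Reduced representations `[I | C]` with `C = [[A, 1], [1ᵀ, w]]` -/

/-- The column, indexed by `x`, of the matrix `[I | C]` whose rows are indexed by
`(X \ {e}) ∪ {f}`, where `C` is the block matrix `[[A, 1], [1ᵀ, w]]` with row block `X \ {e}`,
column block `(E \ X) \ {f}`, last column `e`, last row `f`, and corner entry `w`. -/
noncomputable def colVec (X : Set α) (e f : α) (A : α → α → GF4) (w : GF4) :
    α → ((X \ {e} ∪ {f} : Set α) → GF4) := fun x r =>
  if x ∈ X \ {e} ∪ ({f} : Set α) then (if (r : α) = x then 1 else 0)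
  else if (r : α) = f then (if x = e then w else 1)
  else if x = e then 1 else A (r : α) x

/-- `M = M[I | C]` where `C` is the block matrix `[[A, 1], [1ᵀ, w]]` relative to the
basis `(X \ {e}) ∪ {f}`. -/
def RepBy (M : Matroid α) (X : Set α) (e f : α) (A : α → α → GF4) (w : GF4) : Prop :=
  ∀ I ⊆ M.E, (M.Indep I ↔
    LinearIndependent GF4 (fun x : I => colVec X e f A w (x : α)))

/-- The matrix `B`, with rows restricted to `R` and columns restricted to `K`, has an
`m × n` submatrix (up to permuting rows and columns) equal to the pattern `P`. -/
def HasPattern {m n : ℕ} (B : α → α → GF4) (R K : Set α) (P : Fin m → Fin n → GF4) : Prop :=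
  ∃ (r : Fin m → α) (c : Fin n → α), Function.Injective r ∧ Function.Injective c ∧
    (∀ i, r i ∈ R) ∧ (∀ j, c j ∈ K) ∧ ∀ i j, B (r i) (c j) = P i j

/-- One non-zero element of GF(4). -/
def NZ1 (x : GF4) : Prop := x ≠ 0

/-- Two distinct non-zero elements of GF(4). -/
def NZ2 (x y : GF4) : Prop := x ≠ 0 ∧ y ≠ 0 ∧ x ≠ y

/-- Three distinct non-zero elements of GF(4). -/
def NZ3 (x y z : GF4) : Prop :=
  x ≠ 0 ∧ y ≠ 0 ∧ z ≠ 0 ∧ x ≠ y ∧ x ≠ z ∧ y ≠ z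

/-- `B` (with rows from `R` and columns from `K`) contains one of the fifteen forbidden
submatrices, up to permuting rows and columns, where `x, y, z` denote distinct non-zero
elements of GF(4). -/
def HasForbidden (B : α → α → GF4) (R K : Set α) : Prop :=
  (∃ x y z, NZ3 x y z ∧ HasPattern B R K ![![x, y, z]]) ∨
  (∃ x y, NZ2 x y ∧ HasPattern B R K ![![x, y], ![0, x]]) ∨
  (∃ x y, NZ2 x y ∧ HasPattern B R K ![![x, y], ![y, x]]) ∨
  (∃ x y z, NZ3 x y z ∧ HasPattern B R K ![![x, y], ![z, x]]) ∨
  (∃ x y z, NZ3 x y z ∧ HasPattern B R K ![![x, x], ![y, z]]) ∨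
  (∃ x, NZ1 x ∧ HasPattern B R K ![![x, x, 0], ![x, 0, x]]) ∨
  (∃ x y, NZ2 x y ∧ HasPattern B R K ![![x, x, 0], ![x, 0, y]]) ∨
  (∃ x y, NZ2 x y ∧ HasPattern B R K ![![x, x, 0], ![y, 0, y]]) ∨
  (∃ x y, NZ2 x y ∧ HasPattern B R K ![![x, y, 0], ![x, 0, y]]) ∨
  (∃ x y z, NZ3 x y z ∧ HasPattern B R K ![![x, 0, 0], ![0, y, z]]) ∨
  (∃ x, NZ1 x ∧ HasPattern B R K ![![x, 0, 0], ![0, x, 0], ![0, 0, x]]) ∨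
  (∃ x y, NZ2 x y ∧ HasPattern B R K ![![x, 0, 0], ![0, x, 0], ![0, 0, y]]) ∨
  (∃ x y z, NZ3 x y z ∧ HasPattern B R K ![![x, 0, 0], ![0, y, 0], ![0, 0, z]]) ∨
  (∃ x y, NZ2 x y ∧ HasPattern B R K ![![x, y, x], ![y, y, 0], ![x, 0, 0]]) ∨
  (∃ x y z, NZ3 x y z ∧ HasPattern B R K ![![x, y, x], ![y, y, 0], ![x, 0, z]])

/-! ### The matroids `P₈⁻`, `F₇⁼` and its dual -/

/-- The columns of the GF(3)-matrix `[I₄ | A]` representing `P₈`, where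
`A = [[0,1,1,-1],[1,0,1,1],[1,1,0,1],[-1,1,1,0]]`. -/
def P8cols : Fin 8 → Fin 4 → ZMod 3 :=
  ![![1, 0, 0, 0], ![0, 1, 0, 0], ![0, 0, 1, 0], ![0, 0, 0, 1],
    ![0, 1, 1, -1], ![1, 0, 1, 1], ![1, 1, 0, 1], ![-1, 1, 1, 0]]

/-- `M` is isomorphic to `P₈`. -/
def IsP8 (M : Matroid α) : Prop :=
  ∃ g : α → Fin 8, Set.BijOn g M.E Set.univ ∧
    ∀ I ⊆ M.E, (M.Indep I ↔ LinearIndependent (ZMod 3) (fun x : I => P8cols (g (x : α))))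

/-- `M` is isomorphic to `P₈⁻`: it is obtained from a copy of `P₈` by relaxing one of its
pair of disjoint circuit-hyperplanes. -/
def IsP8Minus (M : Matroid α) : Prop :=
  ∃ (N : Matroid α) (X Y : Set α), IsP8 N ∧ CircuitHyperplane N Y ∧ Disjoint X Y ∧
    IsRelaxation N M X

/-- The columns of the rational matrix representing the non-Fano matroid `F₇⁻`: the seven
non-zero `{0,1}`-vectors of length 3. -/
def F7cols : Fin 7 → Fin 3 → ℚ :=
  ![![1, 0, 0], ![0, 1, 0], ![0, 0, 1], ![1, 1, 0], ![1, 0, 1], ![0, 1, 1], ![1, 1, 1]]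

/-- `M` is isomorphic to the non-Fano matroid `F₇⁻`. -/
def IsF7Minus (M : Matroid α) : Prop :=
  ∃ g : α → Fin 7, Set.BijOn g M.E Set.univ ∧
    ∀ I ⊆ M.E, (M.Indep I ↔ LinearIndependent ℚ (fun x : I => F7cols (g (x : α))))

/-- `M` is isomorphic to `F₇⁼`: it is obtained from a copy of `F₇⁻` by relaxing a
circuit-hyperplane. -/
def IsF7Eq (M : Matroid α) : Prop :=
  ∃ (N : Matroid α) (X : Set α), IsF7Minus N ∧ IsRelaxation N M X

end Relax

namespace Relax

section Pivot

variable {α K : Type*} [Field K] {B : Set α} [Finite B] {v : α → B → K}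

/-- The unit vectors on a coordinate set missing `i` and `k` span exactly the vectors
vanishing at `i` and `k`. -/
lemma mem_span_image_diff_pair_iff (hv : ∀ b : B, v b = Pi.single b 1) (i k : B) (u : B → K) :
    u ∈ Submodule.span K (v '' (B \ {(i : α), (k : α)})) ↔ u i = 0 ∧ u k = 0 := by
  constructor
  · intro hu
    induction hu using Submodule.span_induction with
    | mem x hx =>
      obtain ⟨b, ⟨hb, hbik⟩, rfl⟩ := hx
      have hvb := hv ⟨b, hb⟩
      simp only [mem_insert_iff, mem_singleton_iff, not_or] at hbik
      simp only at hvb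
      rw [hvb]
      constructor
      · exact Pi.single_eq_of_ne (fun h => hbik.1 (congrArg Subtype.val h).symm) _
      · exact Pi.single_eq_of_ne (fun h => hbik.2 (congrArg Subtype.val h).symm) _
    | zero => simp
    | add x y _ _ hx hy => simp [hx, hy]
    | smul c x _ hx => simp [hx]
  · rintro ⟨hi, hk⟩
    have := Fintype.ofFinite B
    rw [pi_eq_sum_univ' u]
    refine Submodule.sum_mem _ fun b _ => ?_
    by_cases hb : b = i ∨ b = k
    · rcases hb with rfl | rfl <;> simp [hi, hk]
    · refine Submodule.smul_mem _ _ (Submodule.subset_span ⟨b, ⟨b.2, ?_⟩, ?_⟩)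
      · simpa [Subtype.ext_iff] using hb
      · rw [hv]

/-- Exchanging the elements `i`, `k` of a basis of unit vectors for `p`, `q` gives an
independent family exactly when the corresponding `2 × 2` minor is non-zero. -/
lemma linearIndepOn_exchange_pair_iff (hv : ∀ b : B, v b = Pi.single b 1) (i k : B) {p q : α}
    (hpq : p ≠ q) (hp : p ∉ B \ {(i : α), (k : α)}) (hq : q ∉ B \ {(i : α), (k : α)}) :
    LinearIndepOn K v (B \ {(i : α), (k : α)} ∪ {p, q}) ↔
      v p i * v q k - v p k * v q i ≠ 0 := by
  have hS : LinearIndepOn K v (B \ {(i : α), (k : α)}) := by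
    have hB : LinearIndepOn K v B := by
      rw [LinearIndepOn, funext hv]
      exact Pi.linearIndependent_single_one B K
    exact hB.mono sdiff_subset
  have hd : Disjoint (B \ {(i : α), (k : α)}) {p, q} := by
    rw [Set.disjoint_right]
    rintro x (rfl | rfl) <;> assumption
  rw [linearIndepOn_union_iff_quotient hd, and_iff_right hS, LinearIndepOn.pair_iff _ hpq]
  simp only [Function.comp_apply, Submodule.mkQ_apply, ← Submodule.Quotient.mk_smul,
    ← Submodule.Quotient.mk_add, Submodule.Quotient.mk_eq_zero, mem_span_image_diff_pair_iff hv,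
    Pi.add_apply, Pi.smul_apply, smul_eq_mul]
  constructor
  · intro h hdet
    have h1 := h (v q k) (-v p k) ⟨by linear_combination hdet, by ring⟩
    have h2 := h (v q i) (-v p i) ⟨by ring, by linear_combination -hdet⟩
    have h3 := h 1 0 ⟨by simpa using h2.2, by simpa using h1.2⟩
    exact one_ne_zero h3.1
  · rintro h c d ⟨h1, h2⟩
    constructor
    · exact (mul_eq_zero.1 (show c * (v p i * v q k - v p k * v q i) = 0 by
        linear_combination v q k * h1 - v q i * h2)).resolve_right h
    · exact (mul_eq_zero.1 (show d * (v p i * v q k - v p k * v q i) = 0 by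
        linear_combination v p i * h2 - v p k * h1)).resolve_right h

end Pivot

variable {α : Type*} {M M' : Matroid α} {X : Set α} {e f : α} {A A' : α → α → GF4} {w : GF4}

lemma colVec_of_mem (b : (X \ {e} ∪ {f} : Set α)) : colVec X e f A w b = Pi.single b 1 := by
  ext r
  simp only [colVec, if_pos b.2, Pi.single_apply, Subtype.ext_iff]

/-- Relaxing `X` does not change the independence of sets not contained in `X`. -/
lemma IsRelaxation.indep_iff (h : IsRelaxation M M' X) {I : Set α} (hI : ¬ I ⊆ X) :
    M'.Indep I ↔ M.Indep I := by
  simp only [Matroid.indep_iff, h.2.2]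
  constructor
  · rintro ⟨B, hB | rfl, hIB⟩
    · exact ⟨B, hB, hIB⟩
    · exact absurd hIB hI
  · rintro ⟨B, hB, hIB⟩
    exact ⟨B, .inl hB, hIB⟩

/-- A `2 × 2` minor of the representation of `M` that involves a column outside `X` vanishes
exactly when the corresponding minor of the representation of the relaxation vanishes. -/
lemma minor_ne_zero_iff (hfin : M.E.Finite) (hrel : IsRelaxation M M' X)
    (hB : M.IsBase (X \ {e} ∪ {f})) (hA : RepBy M X e f A 0) (hA' : RepBy M' X e f A' w)
    (i k : (X \ {e} ∪ {f} : Set α)) {p q : α} (hpq : p ≠ q) (hpE : p ∈ M.E) (hqE : q ∈ M.E)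
    (hpX : p ∉ X) (hp : p ∉ (X \ {e} ∪ {f}) \ {(i : α), (k : α)})
    (hq : q ∉ (X \ {e} ∪ {f}) \ {(i : α), (k : α)}) :
    colVec X e f A' w p i * colVec X e f A' w q k
        - colVec X e f A' w p k * colVec X e f A' w q i ≠ 0 ↔
      colVec X e f A 0 p i * colVec X e f A 0 q k
        - colVec X e f A 0 p k * colVec X e f A 0 q i ≠ 0 := by
  have : Finite (X \ {e} ∪ {f} : Set α) := hfin.subset hB.subset_ground
  have hIE : (X \ {e} ∪ {f}) \ {(i : α), (k : α)} ∪ {p, q} ⊆ M.E := by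
    refine union_subset (sdiff_subset.trans hB.subset_ground) ?_
    rintro x (rfl | rfl) <;> assumption
  rw [← linearIndepOn_exchange_pair_iff colVec_of_mem i k hpq hp hq,
    ← linearIndepOn_exchange_pair_iff colVec_of_mem i k hpq hp hq]
  refine (hA' _ (hIE.trans hrel.2.1.ge)).symm.trans ?_
  rw [hrel.indep_iff fun h => hpX (h (.inr (.inl rfl)))]
  exact hA _ hIE

/-- `GF(4)` has no four pairwise distinct non-zero elements. -/
lemma NZ3.eq_or_eq_or_eq {x y z : GF4} (h : NZ3 x y z) {u : GF4} (hu : u ≠ 0) :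
    u = x ∨ u = y ∨ u = z := by
  by_contra! hne
  have := Fintype.ofFinite GF4
  have hcard : Fintype.card GF4 = 4 := by
    rw [← Nat.card_eq_fintype_card, GaloisField.card 2 2 two_ne_zero]; norm_num
  have hle := Finset.card_le_univ ({0, x, y, z, u} : Finset GF4)
  obtain ⟨hx, hy, hz, hxy, hxz, hyz⟩ := h
  rw [hcard, Finset.card_insert_of_notMem (by simp; tauto),
    Finset.card_insert_of_notMem (by simp; tauto), Finset.card_insert_of_notMem (by simp; tauto),
    Finset.card_pair (by tauto)] at hle
  omega

lemma NZ3.false_of_ne {x y z u : GF4} (h : NZ3 x y z) (hu : u ≠ 0) (hx : x ≠ u) (hy : y ≠ u)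
    (hz : z ≠ u) : False := by
  rcases h.eq_or_eq_or_eq hu with rfl | rfl | rfl <;> contradiction

end Relax

/-- With the setup as given: neither `A` nor `Aᵀ` has a submatrix of the
form `[x y z]` where `x, y, z` are distinct non-zero elements of GF(4); that is, no row and
no column of `A` contains three pairwise distinct non-zero entries. -/
theorem statement15 {α : Type*} (M M' : Matroid α) (X : Set α) (e f : α)
    (A A' : α → α → Relax.GF4) (w : Relax.GF4)
    (hfin : M.E.Finite)
    (hrel : Relax.IsRelaxation M M' X)
    (he : e ∈ X) (hf : f ∈ M.E \ X)
    (hB : M.IsBase (X \ {e} ∪ {f}))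
    (hA : Relax.RepBy M X e f A 0)
    (hw0 : w ≠ 0) (hw1 : w ≠ 1)
    (hA' : Relax.RepBy M' X e f A' w) :
    (¬ ∃ x y z, Relax.NZ3 x y z ∧
        Relax.HasPattern A (X \ {e}) ((M.E \ X) \ {f}) ![![x, y, z]]) ∧
    (¬ ∃ x y z, Relax.NZ3 x y z ∧
        Relax.HasPattern (fun i j => A j i) ((M.E \ X) \ {f}) (X \ {e}) ![![x, y, z]]) := by
  have hfB : f ∈ X \ {e} ∪ {f} := .inr rfl
  have hef : e ≠ f := fun h => hf.2 (h ▸ he)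
  have heB : e ∉ X \ {e} ∪ {f} := by simp [hef]
  have heE : e ∈ M.E := hrel.1.1.1.subset_ground he
  have hcol {j : α} (hj : j ∈ (M.E \ X) \ {f}) : j ∉ X \ {e} ∪ {f} ∧ j ≠ e ∧ j ≠ f :=
    ⟨by rintro (h | h); exacts [hj.1.2 h.1, hj.2 h], fun h => hj.1.2 (h ▸ he), hj.2⟩
  have hrow {i : α} (hi : i ∈ X \ {e}) : i ∈ X \ {e} ∪ {f} ∧ i ≠ f :=
    ⟨.inl hi, fun h => hf.2 (h ▸ hi.1)⟩
  have hzero {i j : α} (hi : i ∈ X \ {e}) (hj : j ∈ (M.E \ X) \ {f}) :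
      A' i j ≠ 0 ↔ A i j ≠ 0 := by
    have h := Relax.minor_ne_zero_iff hfin hrel hB hA hA' ⟨i, (hrow hi).1⟩ ⟨f, hfB⟩ (q := f)
      (hcol hj).2.2 hj.1.1 hf.1 hj.1.2 (fun h => (hcol hj).1 h.1) (by simp)
    simpa [Relax.colVec, hj.1.2, (hrow hi).2, (hcol hj).2] using h
  have hcorner {i j : α} (hi : i ∈ X \ {e}) (hj : j ∈ (M.E \ X) \ {f}) : A' i j ≠ w⁻¹ := by
    have h := Relax.minor_ne_zero_iff hfin hrel hB hA hA' ⟨i, (hrow hi).1⟩ ⟨f, hfB⟩ (q := e)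
      (hcol hj).2.1 hj.1.1 heE hj.1.2 (fun h => (hcol hj).1 h.1) (fun h => heB h.1)
    simp only [Relax.colVec, (hcol hj).1, heB, (hrow hi).2, (hcol hj).2, if_true, if_false] at h
    intro hw
    exact h.2 (by simp) (by simp [hw, hw0])
  have hrowne {i j k : α} (hi : i ∈ X \ {e}) (hj : j ∈ (M.E \ X) \ {f})
      (hk : k ∈ (M.E \ X) \ {f}) (hjk : j ≠ k) : A' i j ≠ A' i k ↔ A i j ≠ A i k := by
    have h := Relax.minor_ne_zero_iff hfin hrel hB hA hA' ⟨i, (hrow hi).1⟩ ⟨f, hfB⟩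
      hjk hj.1.1 hk.1.1 hj.1.2 (fun h => (hcol hj).1 h.1) (fun h => (hcol hk).1 h.1)
    simpa [Relax.colVec, hj.1.2, hk.1.2, (hrow hi).2, (hcol hj).2, (hcol hk).2,
      sub_eq_zero] using h
  have hcolne {i k j : α} (hi : i ∈ X \ {e}) (hk : k ∈ X \ {e})
      (hj : j ∈ (M.E \ X) \ {f}) : A' i j ≠ A' k j ↔ A i j ≠ A k j := by
    have h := Relax.minor_ne_zero_iff hfin hrel hB hA hA' ⟨i, (hrow hi).1⟩ ⟨k, (hrow hk).1⟩
      (q := e) (hcol hj).2.1 hj.1.1 heE hj.1.2 (fun h => (hcol hj).1 h.1) (fun h => heB h.1)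
    simpa [Relax.colVec, hj.1.2, hef, (hrow hi).2, (hrow hk).2, (hcol hj).2,
      sub_eq_zero] using h
  constructor
  · rintro ⟨x, y, z, ⟨hx, hy, hz, hxy, hxz, hyz⟩, r, c, -, hc, hr, hcK, hP⟩
    obtain rfl : A (r 0) (c 0) = x := hP 0 0
    obtain rfl : A (r 0) (c 1) = y := hP 0 1
    obtain rfl : A (r 0) (c 2) = z := hP 0 2
    have ne {a b : Fin 3} (hab : a ≠ b) := hrowne (hr 0) (hcK a) (hcK b) (hc.ne hab)
    have h : Relax.NZ3 (A' (r 0) (c 0)) (A' (r 0) (c 1)) (A' (r 0) (c 2)) :=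
      ⟨(hzero (hr 0) (hcK 0)).2 hx, (hzero (hr 0) (hcK 1)).2 hy, (hzero (hr 0) (hcK 2)).2 hz,
        (ne (by decide)).2 hxy, (ne (by decide)).2 hxz, (ne (by decide)).2 hyz⟩
    exact h.false_of_ne (inv_ne_zero hw0) (hcorner (hr 0) (hcK 0)) (hcorner (hr 0) (hcK 1))
      (hcorner (hr 0) (hcK 2))
  · rintro ⟨x, y, z, ⟨hx, hy, hz, hxy, hxz, hyz⟩, r, c, -, -, hr, hcK, hP⟩
    obtain rfl : A (c 0) (r 0) = x := hP 0 0
    obtain rfl : A (c 1) (r 0) = y := hP 0 1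
    obtain rfl : A (c 2) (r 0) = z := hP 0 2
    have ne (a b : Fin 3) := hcolne (hcK a) (hcK b) (hr 0)
    have h : Relax.NZ3 (A' (c 0) (r 0)) (A' (c 1) (r 0)) (A' (c 2) (r 0)) :=
      ⟨(hzero (hcK 0) (hr 0)).2 hx, (hzero (hcK 1) (hr 0)).2 hy, (hzero (hcK 2) (hr 0)).2 hz,
        (ne 0 1).2 hxy, (ne 0 2).2 hxz, (ne 1 2).2 hyz⟩
    exact h.false_of_ne (inv_ne_zero hw0) (hcorner (hcK 0) (hr 0)) (hcorner (hcK 1) (hr 0))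
      (hcorner (hcK 2) (hr 0))
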